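/- Let R be a noetherian noncommutative unique factorization domain (UFD), let u ∈ R be a nonzero normal element, and let a, b ∈ R be such that u divides a·b or u divides b·a. If no prime element of R divides both u and a, then u divides b. -/

import Mathlib

/-- `u` is a normal element of `R`: `uR = Ru`. -/
def IsNormalElem {R : Type*} [Ring R] (u : R) : Prop :=
  {y : R | ∃ t : R, y = u * t} = {y : R | ∃ t : R, y = t * u}

/-- For a normal element `u`, `u ∣ a` means `a ∈ Ru`. -/
def NDvd {R : Type*} [Ring R] (u a : R) : Prop := ∃ t : R, a = t * u

/-- A prime element of a domain `R`: a nonzero normal element `p` such that `Rp`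
is a completely prime ideal of `R`; in particular `p` is not a unit
(`1 ∉ Rp`). -/
def IsPrimeElem {R : Type*} [Ring R] (p : R) : Prop :=
  p ≠ 0 ∧ IsNormalElem p ∧ ¬ NDvd p 1 ∧
    ∀ a b : R, NDvd p (a * b) → NDvd p a ∨ NDvd p b

/-- `S` is a two-sided ideal of `R`, as a set. -/
def IsIdealSet {R : Type*} [Ring R] (S : Set R) : Prop :=
  (0 : R) ∈ S ∧ (∀ a ∈ S, ∀ b ∈ S, a + b ∈ S) ∧
    ∀ r : R, ∀ a ∈ S, r * a ∈ S ∧ a * r ∈ S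

/-- `S` is a prime two-sided ideal of `R` (elementwise characterization:
`aRb ⊆ S` implies `a ∈ S` or `b ∈ S`, and `S` is proper). -/
def IsPrimeIdealSet {R : Type*} [Ring R] (S : Set R) : Prop :=
  IsIdealSet S ∧ (1 : R) ∉ S ∧
    ∀ a b : R, (∀ t : R, a * t * b ∈ S) → a ∈ S ∨ b ∈ S

/-- Noncommutative unique factorization domain condition: every nonzero prime
ideal contains a prime element. -/
def IsNCUFD (R : Type*) [Ring R] : Prop :=
  ∀ S : Set R, IsPrimeIdealSet S → S ≠ {0} → ∃ p ∈ S, IsPrimeElem p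

theorem IsNormalElem.exists_mul_eq_mul {R : Type*} [Ring R] {u : R} (hu : IsNormalElem u)
    (t : R) : ∃ s : R, u * t = s * u := by
  have h : u * t ∈ {y : R | ∃ t : R, y = u * t} := ⟨t, rfl⟩
  rw [hu] at h
  exact h

theorem IsNormalElem.exists_mul_eq_mul' {R : Type*} [Ring R] {u : R} (hu : IsNormalElem u)
    (t : R) : ∃ s : R, t * u = u * s := by
  have h : t * u ∈ {y : R | ∃ t : R, y = t * u} := ⟨t, rfl⟩
  rw [← hu] at h
  exact h

theorem isNormalElem_of_forall {R : Type*} [Ring R] {u : R}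
    (h₁ : ∀ t : R, ∃ s : R, u * t = s * u) (h₂ : ∀ t : R, ∃ s : R, t * u = u * s) :
    IsNormalElem u := by
  ext y
  constructor
  · rintro ⟨t, rfl⟩
    exact h₁ t
  · rintro ⟨t, rfl⟩
    exact h₂ t

theorem IsNormalElem.of_mul_right {R : Type*} [Ring R] [IsDomain R] {v p : R}
    (hp0 : p ≠ 0) (hp : IsNormalElem p) (hu : IsNormalElem (v * p)) : IsNormalElem v := by
  refine isNormalElem_of_forall (fun t => ?_) (fun t => ?_)
  · obtain ⟨s, hs⟩ := hp.exists_mul_eq_mul' t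
    obtain ⟨r, hr⟩ := hu.exists_mul_eq_mul s
    refine ⟨r, mul_right_cancel₀ hp0 ?_⟩
    rw [mul_assoc, hs, ← mul_assoc, hr, mul_assoc]
  · obtain ⟨s, hs⟩ := hu.exists_mul_eq_mul' t
    obtain ⟨r, hr⟩ := hp.exists_mul_eq_mul s
    refine ⟨r, mul_right_cancel₀ hp0 ?_⟩
    rw [mul_assoc, hs, mul_assoc, hr, mul_assoc]

theorem IsNormalElem.of_mul_left {R : Type*} [Ring R] [IsDomain R] {p w : R}
    (hp0 : p ≠ 0) (hp : IsNormalElem p) (hu : IsNormalElem (p * w)) : IsNormalElem w := by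
  refine isNormalElem_of_forall (fun t => ?_) (fun t => ?_)
  · obtain ⟨s, hs⟩ := hu.exists_mul_eq_mul t
    obtain ⟨r, hr⟩ := hp.exists_mul_eq_mul' s
    refine ⟨r, mul_left_cancel₀ hp0 ?_⟩
    rw [← mul_assoc, hs, ← mul_assoc, hr, mul_assoc]
  · obtain ⟨s, hs⟩ := hp.exists_mul_eq_mul t
    obtain ⟨r, hr⟩ := hu.exists_mul_eq_mul' s
    refine ⟨r, mul_left_cancel₀ hp0 ?_⟩
    rw [← mul_assoc, hs, mul_assoc, hr, mul_assoc]

/-- If a normal element `u` divides a product of prime elements, then `u` is a unit or has a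
prime divisor. -/
theorem exists_isPrimeElem_nDvd_of_mul_mem_closure {R : Type*} [Ring R] [IsDomain R] {u c : R}
    (hu1 : ¬ IsUnit u) (hc : c ∈ Submonoid.closure {p : R | IsPrimeElem p}) :
    ∀ y : R, u * y = c → ∃ p : R, IsPrimeElem p ∧ NDvd p u := by
  induction hc using Submonoid.closure_induction_right with
  | one => exact fun y hy => absurd (IsUnit.of_mul_eq_one y hy) hu1
  | mul_right c hc p hp ih =>
    intro y hy
    rcases hp.2.2.2 u y ⟨c, hy⟩ with h | ⟨y', rfl⟩
    · exact ⟨p, hp, h⟩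
    · exact ih y' (mul_right_cancel₀ hp.1 (by rw [mul_assoc, hy]))

/-- A two-sided ideal maximal among those containing `u` and avoiding a submonoid `M` is prime. -/
theorem exists_isPrimeIdealSet_disjoint {R : Type*} [Ring R] [IsNoetherianRing R] {u : R}
    (hn : IsNormalElem u) (M : Submonoid R) (hM : ∀ x : R, x * u ∉ M) :
    ∃ S : Set R, IsPrimeIdealSet S ∧ u ∈ S ∧ ∀ x ∈ S, x ∉ M := by
  let C : Set (Submodule R R) :=
    {I | (∀ a ∈ I, ∀ r : R, a * r ∈ I) ∧ u ∈ I ∧ ∀ x ∈ I, x ∉ M}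
  have hC : C.Nonempty := by
    refine ⟨Submodule.span R {u}, ?_, Submodule.mem_span_singleton_self u, ?_⟩
    · intro a ha r
      obtain ⟨t, rfl⟩ := Submodule.mem_span_singleton.1 ha
      obtain ⟨s, hs⟩ := hn.exists_mul_eq_mul r
      exact Submodule.mem_span_singleton.2 ⟨t * s, by simp only [smul_eq_mul, mul_assoc, hs]⟩
    · intro x hx
      obtain ⟨t, rfl⟩ := Submodule.mem_span_singleton.1 hx
      exact hM t
  obtain ⟨P, ⟨hPr, huP, hPM⟩, hmax⟩ := set_has_maximal_iff_noetherian.2 ‹IsNoetherian R R› C hC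
  have key : ∀ J : Submodule R R, P ≤ J → (∀ a ∈ J, ∀ r : R, a * r ∈ J) →
      (∃ a ∈ J, a ∉ P) → ∃ c ∈ J, c ∈ M := by
    rintro J hPJ hJ ⟨a, haJ, haP⟩
    by_contra! h
    exact hmax J ⟨hJ, hPJ huP, h⟩ (lt_of_le_of_ne hPJ fun e => haP (e ▸ haJ))
  refine ⟨P, ⟨⟨P.zero_mem, fun a ha b hb => P.add_mem ha hb,
    fun r a ha => ⟨P.smul_mem r ha, hPr a ha r⟩⟩, fun h => hPM 1 h M.one_mem, ?_⟩, huP, hPM⟩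
  intro a b hab
  by_contra! h
  let J : Submodule R R :=
    { carrier := {x | ∀ t : R, x * t * b ∈ P}
      zero_mem' := fun t => by simp
      add_mem' := fun hx hy t => by
        simp only [add_mul]
        exact P.add_mem (hx t) (hy t)
      smul_mem' := fun r x hx t => by
        simp only [smul_eq_mul, mul_assoc]
        simpa only [smul_eq_mul, mul_assoc] using P.smul_mem r (hx t) }
  obtain ⟨c, hcJ, hcM⟩ := key J (fun x hx t => hPr _ (hPr x hx t) b)
    (fun x hx r t => by simpa only [mul_assoc] using hx (r * t)) ⟨a, hab, h.1⟩
  let K : Submodule R R :=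
    { carrier := {y | ∀ t : R, c * t * y ∈ P}
      zero_mem' := fun t => by simp
      add_mem' := fun hx hy t => by
        simp only [mul_add]
        exact P.add_mem (hx t) (hy t)
      smul_mem' := fun r y hy t => by simpa only [smul_eq_mul, mul_assoc] using hy (t * r) }
  obtain ⟨d, hdK, hdM⟩ := key K (fun y hy t => P.smul_mem (c * t) hy)
    (fun y hy r t => by simpa only [mul_assoc] using hPr _ (hy t) r) ⟨b, hcJ, h.2⟩
  exact hPM (c * d) (by simpa using hdK 1) (M.mul_mem hcM hdM)

/-- In a noetherian UFD every nonzero normal nonunit has a prime divisor. -/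
theorem IsNCUFD.exists_isPrimeElem_nDvd {R : Type*} [Ring R] [IsDomain R] [IsNoetherianRing R]
    (hR : IsNCUFD R) {u : R} (hu0 : u ≠ 0) (hn : IsNormalElem u) (hu1 : ¬ IsUnit u) :
    ∃ p : R, IsPrimeElem p ∧ NDvd p u := by
  by_contra hno
  obtain ⟨S, hS, huS, hSM⟩ := exists_isPrimeIdealSet_disjoint hn
    (Submonoid.closure {p : R | IsPrimeElem p}) fun x hx => by
      obtain ⟨y, hy⟩ := hn.exists_mul_eq_mul' x
      exact hno (exists_isPrimeElem_nDvd_of_mul_mem_closure hu1 hx y hy.symm)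
  obtain ⟨p, hpS, hp⟩ := hR S hS fun h => hu0 (by rw [h] at huS; exact huS)
  exact hSM p hpS (Submonoid.subset_closure hp)

/-- **Proposition 2.1(d)** of Goodearl–Yakimov: in a noetherian noncommutative
UFD, if a nonzero normal element `u` divides `a*b` or `b*a` and `u`, `a` have
no common prime divisor, then `u` divides `b`. -/
theorem stmt3 (R : Type*) [Ring R] [IsDomain R]
    [IsNoetherianRing R] [IsNoetherianRing Rᵐᵒᵖ]
    (hR : IsNCUFD R)
    (u a b : R) (hu0 : u ≠ 0) (hn : IsNormalElem u)
    (hdvd : NDvd u (a * b) ∨ NDvd u (b * a))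
    (hcop : ¬ ∃ p : R, IsPrimeElem p ∧ NDvd p u ∧ NDvd p a) :
    NDvd u b := by
  induction hI : Submodule.span R {u} using WellFoundedGT.induction generalizing u b with
  | ind I ih =>
  subst hI
  by_cases hu1 : IsUnit u
  · obtain ⟨w, rfl⟩ := hu1
    exact ⟨b * ↑w⁻¹, by simp⟩
  obtain ⟨p, hp, v, hv⟩ := hR.exists_isPrimeElem_nDvd hu0 hn hu1
  have hpa : ¬ NDvd p a := fun h => hcop ⟨p, hp, ⟨v, hv⟩, h⟩
  rcases hdvd with ⟨t, ht⟩ | ⟨t, ht⟩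
  · subst hv
    obtain ⟨b', rfl⟩ := (hp.2.2.2 a b ⟨t * v, by rw [ht, mul_assoc]⟩).resolve_left hpa
    have hv0 : v ≠ 0 := left_ne_zero_of_mul hu0
    have hvn : IsNormalElem v := .of_mul_right hp.1 hp.2.1 hn
    have hlt : Submodule.span R {v * p} < Submodule.span R {v} := by
      refine lt_of_le_of_ne ?_ fun h => ?_
      · obtain ⟨s, hs⟩ := hvn.exists_mul_eq_mul p
        rw [Submodule.span_singleton_le_iff_mem, Submodule.mem_span_singleton]
        exact ⟨s, hs.symm⟩
      · have hmem := Submodule.mem_span_singleton_self (R := R) v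
        rw [← h] at hmem
        obtain ⟨r, hr⟩ := Submodule.mem_span_singleton.1 hmem
        obtain ⟨s, hs⟩ := hvn.exists_mul_eq_mul' r
        refine hp.2.2.1 ⟨s, mul_left_cancel₀ hv0 ?_⟩
        rw [mul_one, ← mul_assoc, ← hs, mul_assoc]
        exact hr.symm
    obtain ⟨r, rfl⟩ := ih _ hlt v b' hv0 hvn
      (Or.inl ⟨t, mul_right_cancel₀ hp.1 (by rw [mul_assoc, ht, mul_assoc])⟩)
      (by
        rintro ⟨q, hq, ⟨s, rfl⟩, hqa⟩
        obtain ⟨r, hr⟩ := hq.2.1.exists_mul_eq_mul p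
        exact hcop ⟨q, hq, ⟨s * r, by rw [mul_assoc, hr, mul_assoc]⟩, hqa⟩) rfl
    exact ⟨r, mul_assoc r v p⟩
  · obtain ⟨b₁, hb₁⟩ := (hp.2.2.2 b a ⟨t * v, by rw [ht, hv, mul_assoc]⟩).resolve_right hpa
    obtain ⟨b', rfl⟩ : ∃ b', b = p * b' := by
      rw [hb₁]
      exact hp.2.1.exists_mul_eq_mul' b₁
    obtain ⟨w, rfl⟩ : ∃ w, u = p * w := by
      rw [hv]
      exact hp.2.1.exists_mul_eq_mul' v
    have hw0 : w ≠ 0 := right_ne_zero_of_mul hu0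
    have hwn : IsNormalElem w := .of_mul_left hp.1 hp.2.1 hn
    have hlt : Submodule.span R {p * w} < Submodule.span R {w} := by
      refine lt_of_le_of_ne ?_ fun h => ?_
      · rw [Submodule.span_singleton_le_iff_mem, Submodule.mem_span_singleton]
        exact ⟨p, rfl⟩
      · have hmem := Submodule.mem_span_singleton_self (R := R) w
        rw [← h] at hmem
        obtain ⟨r, hr⟩ := Submodule.mem_span_singleton.1 hmem
        refine hp.2.2.1 ⟨r, mul_right_cancel₀ hw0 ?_⟩
        rw [one_mul, mul_assoc]
        exact hr.symm
    obtain ⟨s, hs⟩ := hn.exists_mul_eq_mul' t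
    obtain ⟨x, hx⟩ := hwn.exists_mul_eq_mul s
    obtain ⟨r, rfl⟩ := ih _ hlt w b' hw0 hwn
      (Or.inr ⟨x, mul_left_cancel₀ hp.1 (by rw [← mul_assoc, ht, hs, mul_assoc, hx])⟩)
      (by
        rintro ⟨q, hq, ⟨s, rfl⟩, hqa⟩
        exact hcop ⟨q, hq, ⟨p * s, by rw [mul_assoc]⟩, hqa⟩) rfl
    obtain ⟨y, hy⟩ := hwn.exists_mul_eq_mul' r
    obtain ⟨z, hz⟩ := hn.exists_mul_eq_mul y
    exact ⟨z, by rw [hy, ← mul_assoc, hz]⟩
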